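/- Let A ∈ ℚ^{d×d} have spectral radius ρ(A) < 1 and all (complex) eigenvalues real and strictly positive, with distinct eigenvalues λ₁ < … < λ_k, and let U ⊆ ℝ^d be the convex hull of a finite set E of points with rational coordinates, with 0 in the relative interior of U. Then there exist bilinear forms L_{ij} : ℝ^d × ℝ^d → ℝ (1 ≤ i ≤ k, 0 ≤ j ≤ d−1) with real algebraic coefficients satisfying ⟨Aⁿ u, τ⟩ = ∑_{i,j} C(n,j) λᵢⁿ L_{ij}(u, τ) for all u, τ ∈ ℝ^d and n ∈ ℕ, such that for all τ, τ' ∈ ℝ^d: if τ' ∈ Dom(τ) (meaning: for all u, u' ∈ E and all i, j, L_{ij}(u−u', τ) = 0 implies L_{ij}(u−u', τ') = 0) and τ' is orthogonal to the subspace Aff₀(max_τ(A^∞(U))), then there exists ε₀ > 0 such that for all ε with 0 < ε < ε₀, max_τ(A^∞(U)) ⊆ max_{τ + ε τ'}(A^∞(U)). -/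

import Mathlib

open Matrix

/-- Entrywise coercion of a rational matrix to a real matrix. -/
def ratMat {d : ℕ} (A : Matrix (Fin d) (Fin d) ℚ) : Matrix (Fin d) (Fin d) ℝ :=
  A.map fun q : ℚ => (q : ℝ)

/-- Coercion of a rational vector to a real vector. -/
def ratVec {d : ℕ} (q : Fin d → ℚ) : Fin d → ℝ := fun i => (q i : ℝ)

/-- The spectral radius of `A` is `< 1`: every complex eigenvalue of `A` has absolute
value `< 1`. -/
def SpecRadiusLtOne {d : ℕ} (A : Matrix (Fin d) (Fin d) ℝ) : Prop :=
  ∀ μ ∈ spectrum ℂ (A.map Complex.ofReal), ‖μ‖ < 1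

/-- `A^∞(U) = { ∑_{i=0}^∞ Aⁱ uᵢ : uᵢ ∈ U for all i }`. -/
def Ainf {d : ℕ} (A : Matrix (Fin d) (Fin d) ℝ) (U : Set (Fin d → ℝ)) : Set (Fin d → ℝ) :=
  { y | ∃ u : ℕ → Fin d → ℝ, (∀ i, u i ∈ U) ∧ HasSum (fun i => (A ^ i) *ᵥ u i) y }

/-- `max_τ(C) = { v ∈ C : ∀ w ∈ C, ⟨w, τ⟩ ≤ ⟨v, τ⟩ }`. -/
def maxIn {d : ℕ} (τ : Fin d → ℝ) (C : Set (Fin d → ℝ)) : Set (Fin d → ℝ) :=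
  { v ∈ C | ∀ w ∈ C, w ⬝ᵥ τ ≤ v ⬝ᵥ τ }

/-- `Aff₀(S) = { ∑_{i=1}^m λᵢ uᵢ : m ∈ ℕ, ∑ λᵢ = 0, uᵢ ∈ S }`. -/
def Aff0 {d : ℕ} (S : Set (Fin d → ℝ)) : Set (Fin d → ℝ) :=
  { x | ∃ (m : ℕ) (lam : Fin m → ℝ) (u : Fin m → Fin d → ℝ),
      (∀ i, u i ∈ S) ∧ ∑ i, lam i = 0 ∧ x = ∑ i, lam i • u i }

open Polynomial Filter Asymptotics in
theorem aux_littleO {r s : ℝ} (hr : 0 < r) (hs : 0 < s) (j j' : ℕ)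
    (h : r < s ∨ (r = s ∧ j < j')) :
    (fun n : ℕ => (n.choose j : ℝ) * r ^ n) =o[atTop] fun n : ℕ => (n.choose j' : ℝ) * s ^ n := by
  have h1 : (fun n : ℕ => (n.choose j : ℝ) * r ^ n) =O[atTop] fun n : ℕ => (n : ℝ) ^ j * r ^ n :=
    (isTheta_choose j).1.mul (isBigO_refl _ _)
  have h2 : (fun n : ℕ => (n : ℝ) ^ j' * s ^ n) =O[atTop] fun n : ℕ => (n.choose j' : ℝ) * s ^ n :=
    (isTheta_choose j').2.mul (isBigO_refl _ _)
  refine (h1.trans_isLittleO ?_).trans_isBigO h2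
  rcases h with h | ⟨rfl, h⟩
  · have h3 : (fun n : ℕ => (n : ℝ) ^ j * r ^ n) =o[atTop] fun n : ℕ => s ^ n :=
      isLittleO_pow_const_mul_const_pow_const_pow_of_norm_lt j
        (by rwa [Real.norm_eq_abs, abs_of_pos hr])
    refine h3.trans_isBigO ?_
    refine IsBigO.of_bound 1 ?_
    filter_upwards [eventually_ge_atTop 1] with n hn
    rw [one_mul, norm_mul, norm_pow (n : ℝ)]
    have : (1 : ℝ) ≤ ‖(n : ℝ)‖ ^ j' := by
      apply one_le_pow₀
      simpa using hn
    nlinarith [norm_nonneg (s ^ n)]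
  · refine IsLittleO.mul_isBigO ?_ (isBigO_refl _ _)
    exact (isLittleO_pow_pow_atTop_of_lt h).comp_tendsto tendsto_natCast_atTop_atTop

open Filter Asymptotics in
theorem aux_growth {k d : ℕ} (lam : Fin k → ℝ) (hmono : StrictMono lam) (hpos : ∀ i, 0 < lam i)
    (a b : Fin k → Fin d → ℝ) (hab : ∀ i j, a i j = 0 → b i j = 0) :
    ∃ c > (0 : ℝ), ∀ n : ℕ,
      0 < ∑ i : Fin k, ∑ j : Fin d, (n.choose (j : ℕ) : ℝ) * lam i ^ n * a i j →
      |∑ i : Fin k, ∑ j : Fin d, (n.choose (j : ℕ) : ℝ) * lam i ^ n * b i j| ≤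
        c * ∑ i : Fin k, ∑ j : Fin d, (n.choose (j : ℕ) : ℝ) * lam i ^ n * a i j := by
  classical
  have key : (fun n : ℕ => ∑ i : Fin k, ∑ j : Fin d, (n.choose (j : ℕ) : ℝ) * lam i ^ n * b i j)
      =O[atTop]
      (fun n : ℕ => ∑ i : Fin k, ∑ j : Fin d, (n.choose (j : ℕ) : ℝ) * lam i ^ n * a i j) := by
    let S : Finset (Fin k × Fin d) := Finset.univ.filter fun p => a p.1 p.2 ≠ 0
    rcases S.eq_empty_or_nonempty with hS | hS
    · have ha : ∀ i j, a i j = 0 := by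
        intro i j
        by_contra h
        have : (i, j) ∈ S := by simp [S, h]
        simp [hS] at this
      have hb : ∀ i j, b i j = 0 := fun i j => hab i j (ha i j)
      simp only [ha, hb]
      exact isBigO_refl _ _
    · obtain ⟨p, hpS, hp⟩ := Finset.exists_max_image S (fun p => toLex p) hS
      have hp0 : a p.1 p.2 ≠ 0 := by simpa [S] using hpS
      let h : ℕ → ℝ := fun n => (n.choose (p.2 : ℕ) : ℝ) * lam p.1 ^ n
      have hlt : ∀ q : Fin k × Fin d, q ≠ p → a q.1 q.2 ≠ 0 →
          (fun n : ℕ => (n.choose (q.2 : ℕ) : ℝ) * lam q.1 ^ n) =o[atTop] h := by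
        intro q hq hq0
        have h1 := hp q (by simp [S, hq0])
        have h2 : toLex q < toLex p := lt_of_le_of_ne h1 (fun e => hq (toLex.injective e))
        rw [Prod.Lex.toLex_lt_toLex] at h2
        apply aux_littleO (hpos _) (hpos _)
        rcases h2 with h2 | ⟨h2, h3⟩
        · exact Or.inl (hmono h2)
        · exact Or.inr ⟨by rw [h2], h3⟩
      have hO : ∀ q : Fin k × Fin d, a q.1 q.2 ≠ 0 →
          (fun n : ℕ => (n.choose (q.2 : ℕ) : ℝ) * lam q.1 ^ n) =O[atTop] h := by
        intro q hq0
        by_cases hq : q = p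
        · subst hq; exact isBigO_refl _ _
        · exact (hlt q hq hq0).isBigO
      have hb : (fun n : ℕ => ∑ i : Fin k, ∑ j : Fin d,
          (n.choose (j : ℕ) : ℝ) * lam i ^ n * b i j) =O[atTop] h := by
        refine IsBigO.fun_sum fun i _ => IsBigO.fun_sum fun j _ => ?_
        by_cases h0 : a i j = 0
        · simp only [hab i j h0, mul_zero]
          exact isBigO_zero _ _
        · simp_rw [mul_comm _ (b i j)]
          exact (hO (i, j) h0).const_mul_left _
      have ha : (fun n : ℕ => (∑ i : Fin k, ∑ j : Fin d,
          (n.choose (j : ℕ) : ℝ) * lam i ^ n * a i j) - a p.1 p.2 * h n) =o[atTop] h := by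
        have e : (fun n : ℕ => (∑ i : Fin k, ∑ j : Fin d,
          (n.choose (j : ℕ) : ℝ) * lam i ^ n * a i j) - a p.1 p.2 * h n) =
          fun n : ℕ => ∑ q ∈ Finset.univ.erase p,
            a q.1 q.2 * ((n.choose (q.2 : ℕ) : ℝ) * lam q.1 ^ n) := by
          funext n
          rw [← Fintype.sum_prod_type' (f := fun i j =>
            (n.choose ((j : Fin d) : ℕ) : ℝ) * lam i ^ n * a i j),
            ← Finset.add_sum_erase _ _ (Finset.mem_univ p)]
          simp only [h]
          rw [add_comm, mul_comm (a p.1 p.2), add_sub_cancel_right]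
          exact Finset.sum_congr rfl fun q _ => mul_comm _ _
        rw [e]
        refine IsLittleO.fun_sum fun q hq => ?_
        by_cases h0 : a q.1 q.2 = 0
        · simp only [h0, zero_mul]
          exact isLittleO_zero _ _
        · exact (hlt q (Finset.ne_of_mem_erase hq) h0).const_mul_left _
      have hh : h =O[atTop] (fun n : ℕ => ∑ i : Fin k, ∑ j : Fin d,
          (n.choose (j : ℕ) : ℝ) * lam i ^ n * a i j) := by
        have h1 : (fun n => a p.1 p.2 * h n) =Θ[atTop] h :=
          (isTheta_refl h atTop).const_mul_left hp0
        have h2 : IsEquivalent atTop (fun n : ℕ => ∑ i : Fin k, ∑ j : Fin d,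
          (n.choose (j : ℕ) : ℝ) * lam i ^ n * a i j) (fun n => a p.1 p.2 * h n) :=
          ha.trans_isBigO h1.2
        exact h1.2.trans h2.isBigO_symm
      exact hb.trans hh
  obtain ⟨c, hc, hc'⟩ := bound_of_isBigO_nat_atTop key
  refine ⟨c, hc, fun n hn => ?_⟩
  have := hc' hn.ne'
  rwa [Real.norm_eq_abs, Real.norm_eq_abs, abs_of_pos hn] at this

open Polynomial in
theorem aux_decomp {K : Type*} [Field K] {d k : ℕ} (B : Matrix (Fin d) (Fin d) K)
    (l : Fin k → K) (hinj : Function.Injective l) (hl : ∀ i, l i ≠ 0)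
    (hp : aeval B (∏ i, (X - C (l i)) ^ d) = 0) :
    ∃ L : Fin k → Fin d → Matrix (Fin d) (Fin d) K, ∀ n : ℕ,
      B ^ n = ∑ i : Fin k, ∑ j : Fin d, ((n.choose (j : ℕ) : K) * l i ^ n) • L i j := by
  classical
  rcases isEmpty_or_nonempty (Fin k) with hk | hk
  · simp at hp
    refine ⟨fun i => hk.elim i, fun n => ?_⟩
    rw [← mul_one (B ^ n), hp]
    simp
  have hcop : Pairwise (Function.onFun IsCoprime fun i : Fin k => (X - C (l i)) ^ d) := by
    intro i j hij
    exact (isCoprime_X_sub_C_of_isUnit_sub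
      ((sub_ne_zero.mpr (hinj.ne hij)).isUnit)).pow
  obtain ⟨μ, hμ⟩ := exists_sum_eq_one_iff_pairwise_coprime'.mpr hcop
  let e : Fin k → Matrix (Fin d) (Fin d) K := fun i =>
    aeval B (μ i * ∏ j ∈ {i}ᶜ, (X - C (l j)) ^ d)
  have he1 : ∑ i, e i = 1 := by
    simp only [e]
    rw [← map_sum, hμ, map_one]
  have he0 : ∀ i m, d ≤ m → e i * (B - algebraMap K _ (l i)) ^ m = 0 := by
    intro i m hm
    have h1 : (B - algebraMap K _ (l i)) ^ d = aeval B ((X - C (l i)) ^ d) := by simp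
    obtain ⟨t, rfl⟩ := Nat.exists_eq_add_of_le hm
    rw [pow_add, ← mul_assoc, h1]
    simp only [e]
    rw [← map_mul, mul_assoc, mul_comm (∏ j ∈ {i}ᶜ, (X - C (l j)) ^ d)]
    rw [← Fintype.prod_eq_mul_prod_compl i (fun j => (X - C (l j)) ^ d), map_mul, hp]
    simp
  refine ⟨fun i j => (l i)⁻¹ ^ (j : ℕ) • (e i * (B - algebraMap K _ (l i)) ^ (j : ℕ)),
    fun n => ?_⟩
  conv_lhs => rw [← one_mul (B ^ n), ← he1, Finset.sum_mul]
  refine Finset.sum_congr rfl fun i _ => ?_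
  have hB : B ^ n = ∑ m ∈ Finset.range (n + 1),
      (B - algebraMap K _ (l i)) ^ m * (algebraMap K _ (l i)) ^ (n - m) * (n.choose m : _) := by
    rw [← (show Commute (B - algebraMap K _ (l i)) (algebraMap K _ (l i)) from (Algebra.commutes (l i) (B - algebraMap K _ (l i))).symm).add_pow]
    simp
  set N := B - algebraMap K (Matrix (Fin d) (Fin d) K) (l i) with hN
  let F : ℕ → Matrix (Fin d) (Fin d) K := fun m =>
    ((n.choose m : K) * l i ^ n) • ((l i)⁻¹ ^ m • (e i * N ^ m))
  have h1 : e i * B ^ n = ∑ m ∈ Finset.range (n + 1), F m := by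
    rw [hB, Finset.mul_sum]
    refine Finset.sum_congr rfl fun m hm => ?_
    have hm' : m ≤ n := Nat.lt_succ_iff.mp (Finset.mem_range.mp hm)
    have h2 : l i ^ n * (l i)⁻¹ ^ m = l i ^ (n - m) := by
      rw [← Nat.sub_add_cancel hm', pow_add, mul_assoc, ← mul_pow, mul_inv_cancel₀ (hl i)]
      simp
    simp only [F]
    rw [smul_smul, mul_assoc (n.choose m : K), h2]
    rw [← map_pow, ← map_natCast (algebraMap K (Matrix (Fin d) (Fin d) K)), mul_assoc (N ^ m),
      ← map_mul, ← mul_assoc, mul_comm (l i ^ (n - m)), ← Algebra.commutes, ← Algebra.smul_def]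
  have h2 : ∑ j : Fin d, F j = ∑ m ∈ Finset.range d, F m := Finset.sum_range F |>.symm
  rw [h1]
  refine Eq.trans ?_ h2.symm
  have hF1 : ∀ m, n < m → F m = 0 := by
    intro m hm
    simp [F, Nat.choose_eq_zero_of_lt hm]
  have hF2 : ∀ m, d ≤ m → F m = 0 := by
    intro m hm
    simp only [F]
    rw [he0 i m hm]
    simp
  have h3 : ∑ m ∈ Finset.range (n + 1), F m = ∑ m ∈ Finset.range (n + 1 + d), F m := by
    apply Finset.sum_subset
    · intro x; simp; omega
    · intro x _ hx
      exact hF1 x (by simp at hx; omega)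
  have h4 : ∑ m ∈ Finset.range d, F m = ∑ m ∈ Finset.range (n + 1 + d), F m := by
    apply Finset.sum_subset
    · intro x; simp; omega
    · intro x _ hx
      exact hF2 x (by simpa using hx)
  rw [h3, h4]

open Polynomial in
theorem aux_L {d k : ℕ} (A : Matrix (Fin d) (Fin d) ℚ)
    (lam : Fin k → ℝ) (hmono : StrictMono lam) (hpos : ∀ i, 0 < lam i)
    (hspec : spectrum ℂ (A.map (fun q : ℚ => (q : ℂ))) = Set.range fun i => (lam i : ℂ)) :
    ∃ L : Fin k → Fin d → Matrix (Fin d) (Fin d) ℝ,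
      (∀ i j a b, IsAlgebraic ℚ (L i j a b)) ∧
      ∀ n : ℕ, ratMat A ^ n =
        ∑ i : Fin k, ∑ j : Fin d, ((n.choose (j : ℕ) : ℝ) * lam i ^ n) • L i j := by
  classical
  have hAC : A.map (fun q : ℚ => (q : ℂ)) = A.map (algebraMap ℚ ℂ) := by
    ext; simp
  rw [hAC] at hspec
  have hroot : ∀ z : ℂ, (A.map (algebraMap ℚ ℂ)).charpoly.IsRoot z ↔ ∃ i, (lam i : ℂ) = z := by
    intro z
    rw [← Matrix.mem_spectrum_iff_isRoot_charpoly, hspec, Set.mem_range]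
  have halg : ∀ i, IsAlgebraic ℚ (lam i) := by
    intro i
    have h := (hroot (lam i)).mpr ⟨i, rfl⟩
    rw [Matrix.charpoly_map, IsRoot, eval_map_algebraMap] at h
    have h2 : IsAlgebraic ℚ ((lam i : ℝ) : ℂ) := ⟨A.charpoly, A.charpoly_monic.ne_zero, h⟩
    exact (isAlgebraic_algebraMap_iff (A := ℂ) (algebraMap ℝ ℂ).injective).mp h2
  let K := algebraicClosure ℚ ℝ
  let l : Fin k → K := fun i => ⟨lam i, mem_algebraicClosure_iff.mpr (halg i)⟩
  have hlv : ∀ i, algebraMap K ℝ (l i) = lam i := fun i => rfl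
  let B : Matrix (Fin d) (Fin d) K := A.map (algebraMap ℚ K)
  let φ : K →+* ℂ := Complex.ofRealHom.comp (algebraMap K ℝ)
  have hφl : ∀ i, φ (l i) = (lam i : ℂ) := fun i => rfl
  have hφB : B.map φ = A.map (algebraMap ℚ ℂ) := by
    ext i j
    simp [B]
  have hdvd : B.charpoly ∣ ∏ i, (X - C (l i)) ^ d := by
    rw [← Polynomial.map_dvd_map' φ, ← Matrix.charpoly_map, hφB]
    have hne : Polynomial.map φ (∏ i, (X - C (l i)) ^ d) ≠ 0 := by
      rw [Polynomial.map_ne_zero_iff φ.injective, Finset.prod_ne_zero_iff]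
      intro i _
      exact pow_ne_zero _ (X_sub_C_ne_zero _)
    rw [IsAlgClosed.dvd_iff_roots_le_roots (Matrix.charpoly_monic _).ne_zero hne,
      Multiset.le_iff_count]
    intro z
    by_cases hz : (A.map (algebraMap ℚ ℂ)).charpoly.IsRoot z
    · obtain ⟨i, rfl⟩ := (hroot z).mp hz
      refine le_trans (b := d) ?_ ?_
      · refine (Multiset.count_le_card _ _).trans ((card_roots' _).trans ?_)
        rw [Matrix.charpoly_natDegree_eq_dim, Fintype.card_fin]
      · rw [count_roots, le_rootMultiplicity_iff hne, Polynomial.map_prod]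
        have := Finset.dvd_prod_of_mem (fun j => Polynomial.map φ ((X - C (l j)) ^ d))
          (Finset.mem_univ i)
        simpa [hφl] using this
    · rw [count_roots, rootMultiplicity_eq_zero hz]
      exact Nat.zero_le _
  have hp : aeval B (∏ i, (X - C (l i)) ^ d) = 0 := by
    obtain ⟨q, hq⟩ := hdvd
    rw [hq, map_mul, Matrix.aeval_self_charpoly, zero_mul]
  obtain ⟨L, hL⟩ := aux_decomp B l
    (fun i j h => hmono.injective (by rw [← hlv, ← hlv, h]))
    (fun i h => (hpos i).ne' (by rw [← hlv, h, map_zero])) hp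
  refine ⟨fun i j => (L i j).map (algebraMap K ℝ), ?_, ?_⟩
  · intro i j a b
    exact mem_algebraicClosure_iff.mp (L i j a b).2
  · intro n
    have hA : ratMat A = B.map (algebraMap K ℝ) := by
      ext i j
      simp [B, ratMat]
    have h := congrArg (RingHom.mapMatrix (algebraMap K ℝ)) (hL n)
    rw [map_pow, RingHom.mapMatrix_apply, ← hA] at h
    rw [h]
    simp only [map_sum]
    refine Finset.sum_congr rfl fun i _ => Finset.sum_congr rfl fun j _ => ?_
    ext a b
    simp only [RingHom.mapMatrix_apply, Matrix.map_apply, Matrix.smul_apply, smul_eq_mul,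
      map_mul, map_pow, map_natCast, hlv]

theorem aux_sum_dot {d : ℕ} (τ : Fin d → ℝ) {f : ℕ → Fin d → ℝ} {y : Fin d → ℝ}
    (h : HasSum f y) : HasSum (fun n => f n ⬝ᵥ τ) (y ⬝ᵥ τ) := by
  have := hasSum_sum (s := Finset.univ)
    (fun i _ => ((Pi.hasSum.mp h) i).mul_right (τ i))
  exact this

theorem aux_replace {d : ℕ} {M : Matrix (Fin d) (Fin d) ℝ} {U : Set (Fin d → ℝ)}
    {u : ℕ → Fin d → ℝ} {v : Fin d → ℝ} (hu : ∀ i, u i ∈ U)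
    (hs : HasSum (fun i => (M ^ i) *ᵥ u i) v) (n : ℕ) {x : Fin d → ℝ} (hx : x ∈ U) :
    v + M ^ n *ᵥ (x - u n) ∈ Ainf M U := by
  classical
  refine ⟨Function.update u n x, ?_, ?_⟩
  · intro i
    by_cases h : i = n
    · subst h; simpa using hx
    · simpa [h] using hu i
  · have h2 : HasSum (fun i => if i = n then M ^ n *ᵥ (x - u n) else 0) (M ^ n *ᵥ (x - u n)) :=
      hasSum_ite_eq n _
    convert hs.add h2 using 2 with i
    by_cases h : i = n
    · subst h; simp [Matrix.mulVec_sub]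
    · simp [h]

theorem aux_convex {d : ℕ} (S : Set (Fin d → ℝ)) (M : Matrix (Fin d) (Fin d) ℝ)
    (σ : Fin d → ℝ) (c : ℝ) (h : ∀ x ∈ S, (M *ᵥ x) ⬝ᵥ σ ≤ c) :
    ∀ x ∈ convexHull ℝ S, (M *ᵥ x) ⬝ᵥ σ ≤ c := by
  have hc : Convex ℝ {x : Fin d → ℝ | (M *ᵥ x) ⬝ᵥ σ ≤ c} := by
    refine convex_halfSpace_le (f := fun x => (M *ᵥ x) ⬝ᵥ σ) ⟨?_, ?_⟩ c
    · intro x y; simp [Matrix.mulVec_add, add_dotProduct]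
    · intro r x; simp [Matrix.mulVec_smul]
  exact fun x hx => convexHull_min (t := {x : Fin d → ℝ | (M *ᵥ x) ⬝ᵥ σ ≤ c}) h hc hx

/-- for a rational matrix `A` with `ρ(A) < 1` and all eigenvalues real and
strictly positive (distinct eigenvalues `λ₁ < … < λ_k`), and `U` the convex hull of a
finite rational set `E` with `0` in its relative interior, there are bilinear forms
`L_{ij}` with real algebraic coefficients realizing the expansion
`⟨Aⁿ u, τ⟩ = ∑_{i,j} C(n,j) λᵢⁿ L_{ij}(u, τ)` such that for all `τ, τ'` with
`τ' ∈ Dom(τ)` and `τ'` orthogonal to `Aff₀(max_τ(A^∞(U)))`, there is `ε₀ > 0` with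
`max_τ(A^∞(U)) ⊆ max_{τ+ετ'}(A^∞(U))` for all `0 < ε < ε₀`. -/
theorem maxIn_stable_under_perturbation {d k : ℕ} (A : Matrix (Fin d) (Fin d) ℚ)
    (hrad : SpecRadiusLtOne (ratMat A))
    (lam : Fin k → ℝ) (hmono : StrictMono lam) (hpos : ∀ i, 0 < lam i)
    (hspec : spectrum ℂ (A.map (fun q : ℚ => (q : ℂ))) = Set.range fun i => (lam i : ℂ))
    (E : Finset (Fin d → ℚ)) (U : Set (Fin d → ℝ))
    (hU : U = convexHull ℝ (ratVec '' ↑E))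
    (h0 : ∃ ε > 0, Metric.ball (0 : Fin d → ℝ) ε ∩ (Submodule.span ℝ U : Set (Fin d → ℝ)) ⊆ U) :
    ∃ L : Fin k → Fin d → Matrix (Fin d) (Fin d) ℝ,
      (∀ i j a b, IsAlgebraic ℚ (L i j a b)) ∧
      (∀ (u τ : Fin d → ℝ) (n : ℕ),
        ((ratMat A) ^ n *ᵥ u) ⬝ᵥ τ =
          ∑ i : Fin k, ∑ j : Fin d,
            (n.choose (j : ℕ) : ℝ) * lam i ^ n * (τ ⬝ᵥ (L i j *ᵥ u))) ∧
      ∀ τ τ' : Fin d → ℝ,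
        (∀ u ∈ ratVec '' (↑E : Set (Fin d → ℚ)), ∀ u' ∈ ratVec '' (↑E : Set (Fin d → ℚ)),
            ∀ (i : Fin k) (j : Fin d),
            τ ⬝ᵥ (L i j *ᵥ (u - u')) = 0 → τ' ⬝ᵥ (L i j *ᵥ (u - u')) = 0) →
        (∀ w ∈ Aff0 (maxIn τ (Ainf (ratMat A) U)), τ' ⬝ᵥ w = 0) →
        ∃ ε₀ > (0 : ℝ), ∀ ε : ℝ, 0 < ε → ε < ε₀ →
          maxIn τ (Ainf (ratMat A) U) ⊆ maxIn (τ + ε • τ') (Ainf (ratMat A) U) := by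
  classical
  obtain ⟨L, hLalg, hL⟩ := aux_L A lam hmono hpos hspec
  have hexp : ∀ (u τ : Fin d → ℝ) (n : ℕ),
        ((ratMat A) ^ n *ᵥ u) ⬝ᵥ τ =
          ∑ i : Fin k, ∑ j : Fin d,
            (n.choose (j : ℕ) : ℝ) * lam i ^ n * (τ ⬝ᵥ (L i j *ᵥ u)) := by
    intro u τ n
    rw [hL n, dotProduct_comm]
    simp only [Matrix.sum_mulVec, dotProduct_sum, Matrix.smul_mulVec, dotProduct_smul, smul_eq_mul]
  refine ⟨L, hLalg, hexp, ?_⟩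
  intro τ τ' hdom horth
  set M := ratMat A with hM
  have hc : ∀ p : (Fin d → ℚ) × (Fin d → ℚ), ∃ c > (0 : ℝ), p ∈ E ×ˢ E → ∀ n : ℕ,
      0 < (M ^ n *ᵥ (ratVec p.1 - ratVec p.2)) ⬝ᵥ τ →
      |(M ^ n *ᵥ (ratVec p.1 - ratVec p.2)) ⬝ᵥ τ'| ≤
        c * ((M ^ n *ᵥ (ratVec p.1 - ratVec p.2)) ⬝ᵥ τ) := by
    intro p
    by_cases hp : p ∈ E ×ˢ E
    · rw [Finset.mem_product] at hp
      obtain ⟨c, hc, h⟩ := aux_growth lam hmono hpos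
        (fun i j => τ ⬝ᵥ (L i j *ᵥ (ratVec p.1 - ratVec p.2)))
        (fun i j => τ' ⬝ᵥ (L i j *ᵥ (ratVec p.1 - ratVec p.2)))
        (hdom _ ⟨p.1, hp.1, rfl⟩ _ ⟨p.2, hp.2, rfl⟩)
      refine ⟨c, hc, fun _ n => ?_⟩
      rw [hexp, hexp]
      exact h n
    · exact ⟨1, one_pos, fun h => absurd h hp⟩
  choose c hc0 hc using hc
  set Cc : ℝ := 1 + ∑ p ∈ E ×ˢ E, c p with hCc
  have hsum0 : 0 ≤ ∑ p ∈ E ×ˢ E, c p := Finset.sum_nonneg fun p _ => (hc0 p).le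
  have hCpos : 0 < Cc := by linarith
  refine ⟨1 / Cc, by positivity, ?_⟩
  intro ε hε hεlt
  have hεC : ε * Cc < 1 := by rwa [lt_div_iff₀ hCpos] at hεlt
  have hgrow : ∀ x ∈ E, ∀ y ∈ E, ∀ n : ℕ, 0 < (M ^ n *ᵥ (ratVec x - ratVec y)) ⬝ᵥ τ →
      0 ≤ (M ^ n *ᵥ (ratVec x - ratVec y)) ⬝ᵥ (τ + ε • τ') := by
    intro x hx y hy n hn
    have hmem : (x, y) ∈ E ×ˢ E := Finset.mem_product.mpr ⟨hx, hy⟩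
    have h1 := hc (x, y) hmem n hn
    have h2 : c (x, y) ≤ Cc := by
      have := Finset.single_le_sum (f := c) (fun p _ => (hc0 p).le) hmem
      linarith
    simp only at h1
    rw [dotProduct_add, dotProduct_smul, smul_eq_mul]
    set f := (M ^ n *ᵥ (ratVec x - ratVec y)) ⬝ᵥ τ
    set g := (M ^ n *ᵥ (ratVec x - ratVec y)) ⬝ᵥ τ'
    have h3 : -g ≤ Cc * f :=
      (neg_le_abs g).trans (h1.trans (mul_le_mul_of_nonneg_right h2 hn.le))
    nlinarith [mul_le_mul_of_nonneg_left h3 hε.le, mul_lt_mul_of_pos_right hεC hn]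
  intro v hv
  obtain ⟨⟨u, hu, hs⟩, hmax⟩ := id hv
  refine ⟨⟨u, hu, hs⟩, ?_⟩
  have hle : ∀ n, ∀ x ∈ U, (M ^ n *ᵥ x) ⬝ᵥ τ ≤ (M ^ n *ᵥ u n) ⬝ᵥ τ := by
    intro n x hx
    have := hmax _ (aux_replace hu hs n hx)
    rw [add_dotProduct, Matrix.mulVec_sub, sub_dotProduct] at this
    linarith
  have heq : ∀ n, ∀ x ∈ U, (M ^ n *ᵥ x) ⬝ᵥ τ = (M ^ n *ᵥ u n) ⬝ᵥ τ →
      (M ^ n *ᵥ x) ⬝ᵥ (τ + ε • τ') = (M ^ n *ᵥ u n) ⬝ᵥ (τ + ε • τ') := by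
    intro n x hx he
    have hm : v + M ^ n *ᵥ (x - u n) ∈ maxIn τ (Ainf M U) := by
      refine ⟨aux_replace hu hs n hx, fun w hw => ?_⟩
      rw [add_dotProduct, Matrix.mulVec_sub, sub_dotProduct, he, sub_self, add_zero]
      exact hmax w hw
    have h0 := horth (M ^ n *ᵥ (x - u n)) ⟨2, ![1, -1], ![v + M ^ n *ᵥ (x - u n), v], by
      intro i
      fin_cases i
      · exact hm
      · exact hv, by simp, by simp⟩
    rw [dotProduct_comm, Matrix.mulVec_sub, sub_dotProduct] at h0
    rw [dotProduct_add, dotProduct_add, dotProduct_smul, dotProduct_smul, he, sub_eq_zero.mp h0]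
  have hEU : ∀ x ∈ E, ratVec x ∈ U := by
    intro x hx
    rw [hU]
    exact subset_convexHull ℝ _ ⟨x, hx, rfl⟩
  have hEne : E.Nonempty := by
    rw [Finset.nonempty_iff_ne_empty]
    rintro rfl
    have := hu 0
    rw [hU] at this
    simp at this
  have hfin : ∀ n, ∀ x ∈ U, (M ^ n *ᵥ x) ⬝ᵥ (τ + ε • τ') ≤ (M ^ n *ᵥ u n) ⬝ᵥ (τ + ε • τ') := by
    intro n
    obtain ⟨s, hsE, hsmax⟩ := Finset.exists_max_image E (fun x => (M ^ n *ᵥ ratVec x) ⬝ᵥ τ) hEne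
    have hs1 : (M ^ n *ᵥ ratVec s) ⬝ᵥ τ = (M ^ n *ᵥ u n) ⬝ᵥ τ := by
      refine le_antisymm (hle n _ (hEU s hsE)) ?_
      refine aux_convex (ratVec '' ↑E) (M ^ n) τ _ ?_ (u n) (hU ▸ hu n)
      rintro _ ⟨x, hx, rfl⟩
      exact hsmax x hx
    have hs2 := heq n _ (hEU s hsE) hs1
    have := aux_convex (ratVec '' ↑E) (M ^ n) (τ + ε • τ')
      ((M ^ n *ᵥ u n) ⬝ᵥ (τ + ε • τ')) (by
        rintro _ ⟨x, hx, rfl⟩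
        rcases (hle n _ (hEU x hx)).eq_or_lt with h | h
        · exact (heq n _ (hEU x hx) h).le
        · have h1 := hgrow s hsE x hx n (by
            rw [Matrix.mulVec_sub, sub_dotProduct, hs1]; linarith)
          rw [Matrix.mulVec_sub, sub_dotProduct, hs2] at h1
          linarith)
    intro x hx
    exact this x (hU ▸ hx)
  rintro w ⟨x, hx, hxs⟩
  exact hasSum_le (fun n => hfin n (x n) (hx n)) (aux_sum_dot _ hxs) (aux_sum_dot _ hs)
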